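/- With notation as in the pseudopullback theorem: Ps(Po cof_κ(K), Po cof_κ(L)) = Po Ps(cof_κ(K), cof_κ(L)); that is, a morphism of the pseudopullback P whose K-projection is a pushout of a cofibration between κ-presentable objects of K and whose L-projection is a pushout of a cofibration between κ-presentable objects of L, is itself a pushout (in P) of a morphism of P whose two projections are cofibrations between κ-presentable objects. -/

import Mathlib

open CategoryTheory Category Limits Opposite

universe w v u u' u''

namespace CellularPaper

variable {K : Type u} [Category.{v} K]

/-- The restriction of a chain `F : J ⥤ K` to the elements below `j`. -/
def restrictionLT {J : Type w} [Preorder J] (F : J ⥤ K) (j : J) :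
    {i : J // i < j} ⥤ K :=
  (Monotone.functor (f := fun i : {i : J // i < j} => (i : J)) fun _ _ h => h) ⋙ F

/-- The cocone on the restriction of `F` below `j` with apex `F.obj j`. -/
@[simps]
def coconeLT {J : Type w} [Preorder J] (F : J ⥤ K) (j : J) :
    Cocone (restrictionLT F j) where
  pt := F.obj j
  ι :=
    { app := fun i => F.map (homOfLE i.2.le)
      naturality := fun i i' h => by
        dsimp [restrictionLT, Monotone.functor]
        rw [← F.map_comp]
        simp }

/-- `f` is a transfinite composite of a smooth chain with links in `C`. -/
def IsTransfiniteCompositionOf (C : MorphismProperty K) : MorphismProperty K :=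
  fun A B f =>
    ∃ (J : Type w) (_ : LinearOrder J) (_ : SuccOrder J) (_ : OrderBot J)
      (_ : WellFoundedLT J) (F : J ⥤ K) (c : Cocone F) (_ : IsColimit c)
      (eA : A ≅ F.obj ⊥) (eB : c.pt ≅ B),
      (∀ j : J, ¬IsMax j → C (F.map (homOfLE (Order.le_succ j)))) ∧
      (∀ j : J, Order.IsSuccLimit j → Nonempty (IsColimit (coconeLT F j))) ∧
      eA.hom ≫ c.ι.app ⊥ ≫ eB.hom = f

/-- A cellular structure: a class of morphisms containing all isomorphisms and closed
under pushout and transfinite composition. -/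
structure IsCellular (C : MorphismProperty K) : Prop where
  isos : ∀ {A B : K} (f : A ⟶ B), IsIso f → C f
  pushout : ∀ {A B A' B' : K} {f : A ⟶ B} {u : A ⟶ A'} {v : B ⟶ B'} {g : A' ⟶ B'},
    IsPushout f u v g → C f → C g
  transfinite : ∀ {A B : K} (f : A ⟶ B), IsTransfiniteCompositionOf.{v} C f → C f

/-- `f` is a retract of `g` in the arrow category. -/
def IsRetractOf {A B X Y : K} (f : A ⟶ B) (g : X ⟶ Y) : Prop :=
  ∃ (u : A ⟶ X) (v : B ⟶ Y) (r : X ⟶ A) (s : Y ⟶ B),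
    u ≫ g = f ≫ v ∧ r ≫ f = g ≫ s ∧ u ≫ r = 𝟙 A ∧ v ≫ s = 𝟙 B

/-- The class of retracts of morphisms in `C`. -/
def retracts (C : MorphismProperty K) : MorphismProperty K :=
  fun _ _ f => ∃ (X Y : K) (g : X ⟶ Y), C g ∧ IsRetractOf f g

/-- The class of pushouts of morphisms in `C`. -/
def Po (C : MorphismProperty K) : MorphismProperty K :=
  fun A' B' g => ∃ (A B : K) (f : A ⟶ B) (u : A ⟶ A') (v : B ⟶ B'),
    C f ∧ IsPushout f u v g

/-- A κ-directed preorder. -/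
def IsCardinalDirected (P : Type v) [Preorder P] (κ : Cardinal.{v}) : Prop :=
  ∀ S : Set P, Cardinal.mk S < κ → ∃ p : P, ∀ s ∈ S, s ≤ p

/-- A κ-presentable object: its hom-functor preserves κ-directed colimits. -/
def IsCardinalPresentable (κ : Cardinal.{v}) (A : K) : Prop :=
  ∀ (P : Type v) (_ : Preorder P), IsCardinalDirected P κ →
    Nonempty (PreservesColimitsOfShape P (coyoneda.obj (op A)))

/-- A locally κ-presentable category. -/
structure IsLocallyPresentable (κ : Cardinal.{v}) (K : Type u) [Category.{v} K] : Prop where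
  regular : κ.IsRegular
  hasColimits : HasColimits K
  generators : ∃ (ι : Type v) (G : ι → K), (∀ i, IsCardinalPresentable κ (G i)) ∧
    ∀ X : K, ∃ (P : Type v) (_ : Preorder P) (F : P ⥤ K) (c : Cocone F) (_ : IsColimit c),
      IsCardinalDirected P κ ∧ Nonempty (c.pt ≅ X) ∧ ∀ p : P, ∃ i, Nonempty (F.obj p ≅ G i)

/-- A locally presentable category. -/
def LocallyPresentable (K : Type u) [Category.{v} K] : Prop :=
  ∃ κ : Cardinal.{v}, IsLocallyPresentable κ K

/-- The smallest cellular class containing `X`. -/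
def cellClosure (X : MorphismProperty K) : MorphismProperty K :=
  fun _ _ f => ∀ C : MorphismProperty K, IsCellular C → X ≤ C → C f

/-- `cof(X)`: retracts of transfinite composites of pushouts of `X`. -/
def cofClosure (X : MorphismProperty K) : MorphismProperty K :=
  retracts (IsTransfiniteCompositionOf.{v} (Po X))

/-- The morphism property generated by a family of morphisms. -/
def ofFamily {ι : Type*} {a b : ι → K} (s : ∀ i, a i ⟶ b i) : MorphismProperty K :=
  fun _ _ f => ∃ i, Nonempty (Arrow.mk f ≅ Arrow.mk (s i))

/-- `C` is cofibrantly generated by a set of morphisms. -/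
def IsCofibrantlyGenerated (C : MorphismProperty K) : Prop :=
  ∃ (ι : Type v) (a b : ι → K) (s : ∀ i, a i ⟶ b i),
    C = cofClosure (ofFamily s)

/-- A combinatorial structure on a locally presentable category. -/
structure IsCombinatorial (K : Type u) [Category.{v} K] (C : MorphismProperty K) : Prop where
  locallyPresentable : LocallyPresentable K
  cellular : IsCellular C
  retractClosed : retracts C ≤ C
  cofibrantlyGenerated : IsCofibrantlyGenerated C

/-- `f` is a transfinite composite of length `< κ` of morphisms in `C`. -/
def IsBoundedTransfiniteCompositionOf (κ : Cardinal.{v}) (C : MorphismProperty K) :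
    MorphismProperty K :=
  fun A B f =>
    ∃ (J : Type v) (_ : LinearOrder J) (_ : SuccOrder J) (_ : OrderBot J)
      (_ : WellFoundedLT J), Cardinal.mk J < κ ∧
      ∃ (F : J ⥤ K) (c : Cocone F) (_ : IsColimit c)
        (eA : A ≅ F.obj ⊥) (eB : c.pt ≅ B),
        (∀ j : J, ¬IsMax j → C (F.map (homOfLE (Order.le_succ j)))) ∧
        (∀ j : J, Order.IsSuccLimit j → Nonempty (IsColimit (coconeLT F j))) ∧
        eA.hom ≫ c.ι.app ⊥ ≫ eB.hom = f

/-- The morphisms of `C` with κ-presentable domain and codomain. -/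
def betweenPresentable (κ : Cardinal.{v}) (C : MorphismProperty K) : MorphismProperty K :=
  fun A B f => C f ∧ IsCardinalPresentable κ A ∧ IsCardinalPresentable κ B

/-- `Po_κ(X)`: pushouts of morphisms of `X` between κ-presentable objects. -/
def PoCard (κ : Cardinal.{v}) (X : MorphismProperty K) : MorphismProperty K :=
  betweenPresentable κ (Po X)

/-- The category `psh(K²)`: objects are morphisms of `K`, morphisms are pushout squares. -/
structure PshArrow (K : Type u) [Category.{v} K] : Type max u v where
  arr : Arrow K

instance : Category.{v} (PshArrow K) where
  Hom g f := {φ : g.arr ⟶ f.arr // IsPushout g.arr.hom φ.left φ.right f.arr.hom}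
  id g := ⟨𝟙 _, IsPushout.of_vert_isIso ⟨by simp⟩⟩
  comp φ ψ := ⟨φ.1 ≫ ψ.1, φ.2.paste_vert ψ.2⟩
  id_comp φ := Subtype.ext (Category.id_comp _)
  comp_id φ := Subtype.ext (Category.comp_id _)
  assoc _ _ _ := Subtype.ext (Category.assoc _ _ _)


section PsPull

variable {K : Type u} {L : Type u'} {M : Type u''}
variable [Category.{v} K] [Category.{v} L] [Category.{v} M]

/-- The pseudopullback of `F : K ⥤ M` and `G : L ⥤ M`. -/
structure PsPull (F : K ⥤ M) (G : L ⥤ M) : Type max u u' v where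
  k : K
  l : L
  t : F.obj k ≅ G.obj l

variable {F : K ⥤ M} {G : L ⥤ M}

/-- Morphisms in the pseudopullback. -/
@[ext]
structure PsHom (a b : PsPull F G) : Type v where
  hk : a.k ⟶ b.k
  hl : a.l ⟶ b.l
  w : F.map hk ≫ b.t.hom = a.t.hom ≫ G.map hl

instance : Category.{v} (PsPull F G) where
  Hom := PsHom
  id a := ⟨𝟙 _, 𝟙 _, by simp⟩
  comp f g := ⟨f.hk ≫ g.hk, f.hl ≫ g.hl, by
    rw [F.map_comp, G.map_comp, Category.assoc, g.w, ← Category.assoc, f.w,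
      Category.assoc]⟩

/-- The first projection of the pseudopullback. -/
def projK (F : K ⥤ M) (G : L ⥤ M) : PsPull F G ⥤ K where
  obj a := a.k
  map f := f.hk

/-- The second projection of the pseudopullback. -/
def projL (F : K ⥤ M) (G : L ⥤ M) : PsPull F G ⥤ L where
  obj a := a.l
  map f := f.hl

/-- `Ps(C, D)`: morphisms of the pseudopullback whose projections lie in `C` and `D`. -/
def PsClass (C : MorphismProperty K) (D : MorphismProperty L) :
    MorphismProperty (PsPull F G) :=
  fun _ _ f => C f.hk ∧ D f.hl

end PsPull

section Presentability

variable {κ : Cardinal.{v}} [Fact κ.IsRegular]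

theorem isCardinalDirected_iff (P : Type v) [Preorder P] :
    IsCardinalDirected P κ ↔ IsCardinalFiltered P κ := by
  constructor
  · intro h
    refine isCardinalFiltered_preorder _ _ fun ι s hs => ?_
    obtain ⟨p, hp⟩ := h (Set.range s) (Cardinal.mk_range_le.trans_lt hs)
    exact ⟨p, fun k => hp _ ⟨k, rfl⟩⟩
  · intro _ S hS
    have hS' : HasCardinalLT S κ := by rwa [hasCardinalLT_iff_cardinal_mk_lt]
    exact ⟨IsCardinalFiltered.max (fun s : S => s.1) hS', fun s hs =>
      leOfHom (IsCardinalFiltered.toMax (fun s : S => s.1) hS' ⟨s, hs⟩)⟩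

theorem isCardinalPresentable_iff (A : K) :
    IsCardinalPresentable κ A ↔ CategoryTheory.IsCardinalPresentable A κ := by
  constructor
  · intro h
    refine ⟨fun J _ _ => ?_⟩
    obtain ⟨P, _, _, Φ, _⟩ := IsCardinalFiltered.exists_cardinal_directed J κ
    obtain ⟨_⟩ := h P inferInstance ((isCardinalDirected_iff P).2 inferInstance)
    exact Functor.Final.preservesColimitsOfShape_of_final Φ _
  · intro _ P _ hP
    have := (isCardinalDirected_iff P).1 hP
    exact ⟨preservesColimitsOfShape_of_isCardinalPresentable A κ P⟩

theorem isCardinalPresentable_arrow [HasColimitsOfSize.{v, v} K] (f : Arrow K)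
    [CategoryTheory.IsCardinalPresentable f.left κ]
    [CategoryTheory.IsCardinalPresentable f.right κ] :
    CategoryTheory.IsCardinalPresentable f κ := by
  refine ⟨fun J _ _ => ⟨fun {X} => ⟨fun {c} hc => ?_⟩⟩⟩
  have := isFiltered_of_isCardinalFiltered J κ
  have hl : IsColimit (Arrow.leftFunc.mapCocone c) := isColimitOfPreserves _ hc
  have hr : IsColimit (Arrow.rightFunc.mapCocone c) := isColimitOfPreserves _ hc
  have wl {i j : J} (p : i ⟶ j) : (X.map p).left ≫ (c.ι.app j).left = (c.ι.app i).left :=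
    congrArg CommaMorphism.left (c.w p)
  have wr {i j : J} (p : i ⟶ j) : (X.map p).right ≫ (c.ι.app j).right = (c.ι.app i).right :=
    congrArg CommaMorphism.right (c.w p)
  refine ⟨Types.FilteredColimit.isColimitOf _ _ ?_ ?_⟩
  · intro (φ : f ⟶ c.pt)
    obtain ⟨i, a, ha⟩ : ∃ (i : J) (a : f.left ⟶ (X.obj i).left),
        a ≫ (c.ι.app i).left = φ.left :=
      IsCardinalPresentable.exists_hom_of_isColimit κ hl φ.left
    obtain ⟨j, b, hb⟩ : ∃ (j : J) (b : f.right ⟶ (X.obj j).right),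
        b ≫ (c.ι.app j).right = φ.right :=
      IsCardinalPresentable.exists_hom_of_isColimit κ hr φ.right
    have hab : (a ≫ (X.obj i).hom) ≫ (c.ι.app i).right =
        (f.hom ≫ b) ≫ (c.ι.app j).right := by
      have h₁ : (c.ι.app i).left ≫ c.pt.hom = (X.obj i).hom ≫ (c.ι.app i).right :=
        (c.ι.app i).w
      have h₂ : φ.left ≫ c.pt.hom = f.hom ≫ φ.right := φ.w
      rw [assoc, assoc, hb, ← h₂, ← ha, assoc, h₁]
    obtain ⟨k, p, q, h⟩ : ∃ (k : J) (p : i ⟶ k) (q : j ⟶ k),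
        (a ≫ (X.obj i).hom) ≫ (X.map p).right = (f.hom ≫ b) ≫ (X.map q).right :=
      IsCardinalPresentable.exists_eq_of_isColimit κ hr _ _ hab
    refine ⟨k, Arrow.homMk (a ≫ (X.map p).left) (b ≫ (X.map q).right) ?_, ?_⟩
    · have h₁ : (X.map p).left ≫ (X.obj k).hom = (X.obj i).hom ≫ (X.map p).right :=
        (X.map p).w
      rw [assoc, h₁, ← assoc, h, assoc]
    · refine Arrow.hom_ext _ _ (Eq.symm ?_) (Eq.symm ?_)
      · exact (assoc _ _ _).trans ((congrArg _ (wl p)).trans ha)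
      · exact (assoc _ _ _).trans ((congrArg _ (wr q)).trans hb)
  · intro i j (φ : f ⟶ X.obj i) (ψ : f ⟶ X.obj j) (h : φ ≫ c.ι.app i = ψ ≫ c.ι.app j)
    obtain ⟨k, p, q, hk⟩ : ∃ (k : J) (p : i ⟶ k) (q : j ⟶ k),
        φ.left ≫ (X.map p).left = ψ.left ≫ (X.map q).left :=
      IsCardinalPresentable.exists_eq_of_isColimit κ hl
        φ.left ψ.left (congrArg CommaMorphism.left h)
    have hr' : (φ.right ≫ (X.map p).right) ≫ (c.ι.app k).right =
        (ψ.right ≫ (X.map q).right) ≫ (c.ι.app k).right := by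
      rw [assoc, assoc, wr, wr]
      exact congrArg CommaMorphism.right h
    obtain ⟨l, r, hm⟩ : ∃ (l : J) (r : k ⟶ l),
        (φ.right ≫ (X.map p).right) ≫ (X.map r).right =
          (ψ.right ≫ (X.map q).right) ≫ (X.map r).right :=
      IsCardinalPresentable.exists_eq_of_isColimit' κ hr _ _ hr'
    refine ⟨l, p ≫ r, q ≫ r, ?_⟩
    change φ ≫ X.map (p ≫ r) = ψ ≫ X.map (q ≫ r)
    refine Arrow.hom_ext _ _ ?_ ?_
    · simp [reassoc_of% hk]
    · simpa using hm

end Presentability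

section BackAndForth

variable {N : Type u} [Category.{v} N] {κ : Cardinal.{w}} [Fact κ.IsRegular]

theorem exists_extension {I J : Type w} [Preorder I] [Preorder J] [IsCardinalFiltered J κ]
    {U : I ⥤ N} {V : J ⥤ N} {cU : Cocone U} {cV : Cocone V} (hV : IsColimit cV)
    [∀ i, CategoryTheory.IsCardinalPresentable (U.obj i) κ]
    [∀ j, CategoryTheory.IsCardinalPresentable (V.obj j) κ]
    (t : cU.pt ≅ cV.pt) {i : I} {j : J} (β : V.obj j ⟶ U.obj i)
    (hβ : β ≫ cU.ι.app i = cV.ι.app j ≫ t.inv) :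
    ∃ (j' : J) (h : j ≤ j') (α : U.obj i ⟶ V.obj j'),
      α ≫ cV.ι.app j' = cU.ι.app i ≫ t.hom ∧ β ≫ α = V.map (homOfLE h) := by
  obtain ⟨j₁, α, hα⟩ := IsCardinalPresentable.exists_hom_of_isColimit κ hV (cU.ι.app i ≫ t.hom)
  obtain ⟨j₂, p, q, h⟩ := IsCardinalPresentable.exists_eq_of_isColimit κ hV
    (β ≫ α) (𝟙 (V.obj j)) (by simp [hα, reassoc_of% hβ])
  exact ⟨j₂, leOfHom q, α ≫ V.map p, by simpa using hα, by
    rw [← assoc, h, id_comp]; rfl⟩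

theorem exists_sequences {I J : Type w} [Preorder I] [Preorder J] [IsCardinalFiltered I κ]
    [IsCardinalFiltered J κ]
    {U : I ⥤ N} {V : J ⥤ N} {cU : Cocone U} {cV : Cocone V}
    (hU : IsColimit cU) (hV : IsColimit cV)
    [∀ i, CategoryTheory.IsCardinalPresentable (U.obj i) κ]
    [∀ j, CategoryTheory.IsCardinalPresentable (V.obj j) κ]
    (t : cU.pt ≅ cV.pt) :
    ∃ (p : ℕ ⥤ I) (q : ℕ ⥤ J) (α : p ⋙ U ⟶ q ⋙ V)
      (β : ∀ n, V.obj (q.obj n) ⟶ U.obj (p.obj (n + 1))),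
      (∀ n, α.app n ≫ cV.ι.app (q.obj n) = cU.ι.app (p.obj n) ≫ t.hom) ∧
      (∀ n, α.app n ≫ β n = U.map (p.map (homOfLE (n.le_add_right 1)))) ∧
      (∀ n, β n ≫ α.app (n + 1) = V.map (q.map (homOfLE (n.le_add_right 1)))) := by
  let S := Σ (i : I) (j : J),
    {α : U.obj i ⟶ V.obj j // α ≫ cV.ι.app j = cU.ι.app i ≫ t.hom}
  have start : Nonempty S := by
    obtain ⟨i⟩ := IsCardinalFiltered.nonempty I κ
    obtain ⟨j, α, hα⟩ :=
      IsCardinalPresentable.exists_hom_of_isColimit κ hV (cU.ι.app i ≫ t.hom)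
    exact ⟨⟨i, j, α, hα⟩⟩
  have step (s : S) : ∃ (s' : S) (hi : s.1 ≤ s'.1) (hj : s.2.1 ≤ s'.2.1)
      (β : V.obj s.2.1 ⟶ U.obj s'.1),
      s.2.2.1 ≫ β = U.map (homOfLE hi) ∧ β ≫ s'.2.2.1 = V.map (homOfLE hj) := by
    obtain ⟨i, j, α, hα⟩ := s
    obtain ⟨i', hi, β, hβ, hαβ⟩ := exists_extension (κ := κ) hU t.symm α hα
    obtain ⟨j', hj, α', hα', hβα⟩ := exists_extension (κ := κ) hV t β hβ
    exact ⟨⟨i', j', α', hα'⟩, hi, hj, β, hαβ, hβα⟩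
  choose next hi hj β hαβ hβα using step
  let s (n : ℕ) : S := Nat.rec start.some (fun _ => next) n
  have hp : Monotone fun n => (s n).1 := monotone_nat_of_le_succ fun n => hi (s n)
  have hq : Monotone fun n => (s n).2.1 := monotone_nat_of_le_succ fun n => hj (s n)
  refine ⟨hp.functor, hq.functor, NatTrans.ofSequence (fun n => (s n).2.2.1) fun n => ?_,
    fun n => β (s n), fun n => (s n).2.2.2, fun n => hαβ (s n), fun n => hβα (s n)⟩
  change U.map (homOfLE (hi (s n))) ≫ (s (n + 1)).2.2.1 =
    (s n).2.2.1 ≫ V.map (homOfLE (hj (s n)))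
  rw [← hαβ, ← hβα, assoc]

theorem exists_iso_of_interleaving {U V : ℕ ⥤ N} (α : U ⟶ V)
    (β : ∀ n, V.obj n ⟶ U.obj (n + 1))
    (hαβ : ∀ n, α.app n ≫ β n = U.map (homOfLE (n.le_add_right 1)))
    (hβα : ∀ n, β n ≫ α.app (n + 1) = V.map (homOfLE (n.le_add_right 1)))
    {cU : Cocone U} {cV : Cocone V} (hU : IsColimit cU) (hV : IsColimit cV) :
    ∃ e : cU.pt ≅ cV.pt, ∀ n, cU.ι.app n ≫ e.hom = α.app n ≫ cV.ι.app n := by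
  let γ : V ⟶ (Functor.const ℕ).obj cU.pt :=
    NatTrans.ofSequence (fun n => β n ≫ cU.ι.app (n + 1)) fun n => by
      dsimp
      rw [comp_id, ← hβα, assoc, reassoc_of% (hαβ (n + 1)), cU.w]
  refine ⟨⟨hU.map cV α, hV.desc ⟨_, γ⟩, hU.hom_ext fun n => ?_, hV.hom_ext fun n => ?_⟩,
    fun n => by simp⟩
  · simp [γ, reassoc_of% (hαβ n)]
  · simp [γ, reassoc_of% (hβα n)]

end BackAndForth

section PushoutSquares

variable {J : Type w} [Preorder J] [OrderBot J] {A B : J ⥤ K} (α : A ⟶ B)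
  (hα : ∀ j, IsPushout (α.app ⊥) (A.map (homOfLE (bot_le : ⊥ ≤ j)))
    (B.map (homOfLE (bot_le : ⊥ ≤ j))) (α.app j))
  {cA : Cocone A} {cB : Cocone B} (f : cA.pt ⟶ cB.pt)
  (hf : ∀ j, cA.ι.app j ≫ f = α.app j ≫ cB.ι.app j)

include hα hf

theorem nonempty_isColimit_of_isPushout (hA : IsColimit cA)
    (h : IsPushout (α.app ⊥) (cA.ι.app ⊥) (cB.ι.app ⊥) f) : Nonempty (IsColimit cB) := by
  let left (s : Cocone B) : Cocone A := (Cocone.precompose α).obj s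
  have fac (s : Cocone B) (j : J) :
      cA.ι.app j ≫ hA.desc (left s) = α.app j ≫ s.ι.app j := hA.fac (left s) j
  refine ⟨⟨fun s => h.desc (s.ι.app ⊥) (hA.desc (left s)) (fac s ⊥).symm,
    fun s j => ?_, fun s m hm => ?_⟩⟩
  · refine (hα j).hom_ext ?_ ?_
    · simp
    · rw [← reassoc_of% hf, IsPushout.inr_desc, fac]
  · refine h.hom_ext ?_ ?_
    · rw [IsPushout.inl_desc, hm]
    · rw [IsPushout.inr_desc]
      refine hA.hom_ext fun j => ?_
      rw [fac, reassoc_of% hf, hm]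

theorem isPushout_of_isColimit (hA : IsColimit cA) (hB : IsColimit cB) :
    IsPushout (α.app ⊥) (cA.ι.app ⊥) (cB.ι.app ⊥) f := by
  let right (s : PushoutCocone (α.app ⊥) (cA.ι.app ⊥)) : Cocone B :=
    { pt := s.pt
      ι :=
        { app := fun j => (hα j).desc s.inl (cA.ι.app j ≫ s.inr) (by simp [s.condition])
          naturality := fun j j' h => by
            refine (hα j).hom_ext ?_ ?_
            · have e : B.map (homOfLE (bot_le : ⊥ ≤ j)) ≫ B.map h =
                  B.map (homOfLE (bot_le : ⊥ ≤ j')) := (B.map_comp _ _).symm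
              simp [reassoc_of% e]
            · simp [← NatTrans.naturality_assoc, reassoc_of% (cA.w h)] } }
  have fac (s : PushoutCocone (α.app ⊥) (cA.ι.app ⊥)) (j : J) :
      cB.ι.app j ≫ hB.desc (right s) = (right s).ι.app j := hB.fac _ j
  refine ⟨⟨(hf ⊥).symm⟩, ⟨PushoutCocone.IsColimit.mk _ (fun s => hB.desc (right s))
    (fun s => ?_) (fun s => ?_) (fun s m h₁ h₂ => ?_)⟩⟩
  · rw [fac]
    have e : 𝟙 _ = B.map (homOfLE (bot_le : (⊥ : J) ≤ ⊥)) := (B.map_id _).symm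
    refine (id_comp _).symm.trans ((congrArg (· ≫ _) e).trans ?_)
    exact (hα ⊥).inl_desc _ _ _
  · refine hA.hom_ext fun j => ?_
    rw [reassoc_of% hf, fac, IsPushout.inr_desc]
  · refine hB.hom_ext fun j => ?_
    rw [fac]
    refine (hα j).hom_ext ?_ ?_
    · simpa [right] using h₁
    · simp [right, ← reassoc_of% hf, h₂]

end PushoutSquares

section PushoutPresentation

variable {κ : Cardinal.{v}} [Fact κ.IsRegular]

theorem isCardinalPresentable_of_isPushout {A B A' B' : K} {f : A ⟶ B} {u : A ⟶ A'}
    {v : B ⟶ B'} {g : A' ⟶ B'} (h : IsPushout f u v g)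
    [CategoryTheory.IsCardinalPresentable A κ] [CategoryTheory.IsCardinalPresentable B κ]
    [CategoryTheory.IsCardinalPresentable A' κ] :
    CategoryTheory.IsCardinalPresentable B' κ := by
  have (k : WalkingSpan) : CategoryTheory.IsCardinalPresentable ((span f u).obj k) κ := by
    rcases k with _ | _ | _ <;> dsimp <;> infer_instance
  exact isCardinalPresentable_of_isColimit h.cocone h.isColimit κ
    (hasCardinalLT_of_finite _ _ (Fact.out : κ.IsRegular).aleph0_le)

theorem isCardinalPresentable_of_isColimit_nat (hκ : Cardinal.aleph0 < κ) {X : ℕ ⥤ K}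
    {c : Cocone X} (hc : IsColimit c)
    [∀ n, CategoryTheory.IsCardinalPresentable (X.obj n) κ] :
    CategoryTheory.IsCardinalPresentable c.pt κ := by
  have : Countable (Arrow ℕ) :=
    Function.Injective.countable (f := fun φ : Arrow ℕ => (φ.left, φ.right)) fun φ ψ h => by
      obtain ⟨a, b, p⟩ := φ
      obtain ⟨a', b', q⟩ := ψ
      obtain ⟨rfl, rfl⟩ := Prod.ext_iff.1 h
      obtain rfl : p = q := Subsingleton.elim (α := a ⟶ b) _ _
      rfl
  refine isCardinalPresentable_of_isColimit c hc κ ?_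
  rw [HasCardinalLT]
  refine lt_of_le_of_lt ?_ (Cardinal.lift_strictMono hκ)
  simp

/-- The functor of pushouts of `f` along the components of the cone `s`. -/
@[simps]
noncomputable def pushoutFunctor [HasPushouts K] {J : Type w} [SmallCategory J] {A B : K}
    {W : J ⥤ K} (s : ∀ j, A ⟶ W.obj j)
    (hs : ∀ {j j' : J} (φ : j ⟶ j'), s j ≫ W.map φ = s j') (f : A ⟶ B) : J ⥤ K where
  obj j := pushout f (s j)
  map {j j'} φ := pushout.desc (pushout.inl f (s j')) (W.map φ ≫ pushout.inr f (s j')) (by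
    rw [reassoc_of% (hs φ), pushout.condition])
  map_id j := by apply pushout.hom_ext <;> simp
  map_comp φ ψ := by
    apply pushout.hom_ext <;> simp [pushout.inl_desc, pushout.inl_desc_assoc,
      pushout.inr_desc, pushout.inr_desc_assoc]

/-- The natural transformation from `W` to the functor of pushouts. -/
@[simps]
noncomputable def pushoutFunctorInr [HasPushouts K] {J : Type w} [SmallCategory J] {A B : K}
    {W : J ⥤ K} (s : ∀ j, A ⟶ W.obj j)
    (hs : ∀ {j j' : J} (φ : j ⟶ j'), s j ≫ W.map φ = s j') (f : A ⟶ B) :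
    W ⟶ pushoutFunctor s hs f where
  app j := pushout.inr f (s j)
  naturality _ _ _ := (pushout.inr_desc _ _ _).symm

/-- A natural transformation as a functor to the arrow category. -/
@[simps]
def arrowFunctor {J : Type w} [SmallCategory J] {A B : J ⥤ K} (α : A ⟶ B) : J ⥤ Arrow K where
  obj j := Arrow.mk (α.app j)
  map φ := Arrow.homMk (A.map φ) (B.map φ)

/-- A presentation of an arrow as a `κ`-directed colimit of morphisms of `C` between
`κ`-presentable objects, all transition morphisms being pushout squares. -/
structure PushoutPresentation (κ : Cardinal.{v}) [Fact κ.IsRegular] (C : MorphismProperty K)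
    (g : Arrow K) where
  I : Type v
  [preorder : Preorder I]
  [orderBot : OrderBot I]
  [isCardinalFiltered : IsCardinalFiltered I κ]
  X : I ⥤ Arrow K
  ι : X ⟶ (Functor.const I).obj g
  isColimit : IsColimit (Cocone.mk g ι)
  mem : ∀ i, betweenPresentable κ C (X.obj i).hom
  isPushout : ∀ i, IsPushout (X.obj ⊥).hom (X.map (homOfLE (bot_le : ⊥ ≤ i))).left
    (X.map (homOfLE (bot_le : ⊥ ≤ i))).right (X.obj i).hom

attribute [instance] PushoutPresentation.preorder PushoutPresentation.orderBot
  PushoutPresentation.isCardinalFiltered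

variable {C : MorphismProperty K}

theorem nonempty_pushoutPresentation_of_isColimit (hC : IsCellular C) [HasPushouts K]
    {I : Type v} [Preorder I] [OrderBot I] [IsCardinalFiltered I κ] {W : I ⥤ K} {cW : Cocone W}
    (hcW : IsColimit cW) [∀ i, CategoryTheory.IsCardinalPresentable (W.obj i) κ] {A B b : K}
    [CategoryTheory.IsCardinalPresentable A κ] [CategoryTheory.IsCardinalPresentable B κ]
    {f : A ⟶ B} (hf : C f) (s : ∀ i, A ⟶ W.obj i)
    (hs : ∀ {i j : I} (h : i ⟶ j), s i ≫ W.map h = s j) {u : A ⟶ cW.pt}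
    (hsu : ∀ i, s i ≫ cW.ι.app i = u) {v : B ⟶ b} {g : cW.pt ⟶ b} (sq : IsPushout f u v g) :
    Nonempty (PushoutPresentation κ C (Arrow.mk g)) := by
  have hpo (i : I) : IsPushout f (s i) (pushout.inl f (s i))
      (pushout.inr f (s i)) := IsPushout.of_hasPushout _ _
  let cB : Cocone (pushoutFunctor s hs f) :=
    { pt := b
      ι :=
        { app := fun i => (hpo i).desc v (cW.ι.app i ≫ g) (by rw [reassoc_of% hsu, sq.w])
          naturality := fun i j h => by
            have e : W.map h ≫ cW.ι.app j = cW.ι.app i := cW.w h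
            refine Eq.trans ((hpo i).hom_ext ?_ ?_) (comp_id _).symm
            · exact (pushout.inl_desc_assoc _ _ _ _).trans
                (((hpo j).inl_desc _ _ _).trans ((hpo i).inl_desc _ _ _).symm)
            · refine ((pushout.inr_desc_assoc _ _ _ _).trans (assoc _ _ _)).trans ?_
              refine (congrArg (W.map h ≫ ·) ((hpo j).inr_desc _ _ _)).trans ?_
              rw [← assoc, e]
              exact ((hpo i).inr_desc _ _ _).symm } }
  have hα (i : I) : IsPushout ((pushoutFunctorInr s hs f).app ⊥)
      (W.map (homOfLE (bot_le : ⊥ ≤ i))) ((pushoutFunctor s hs f).map (homOfLE (bot_le : ⊥ ≤ i)))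
      ((pushoutFunctorInr s hs f).app i) := by
    refine IsPushout.of_top ?_ ((pushoutFunctorInr s hs f).naturality _).symm (hpo ⊥)
    have e₁ : s ⊥ ≫ W.map (homOfLE (bot_le : ⊥ ≤ i)) = s i :=
      hs _
    have e₂ : pushout.inl f (s ⊥) ≫ (pushoutFunctor s hs f).map (homOfLE (bot_le : ⊥ ≤ i)) =
      pushout.inl f (s i) := pushout.inl_desc _ _ _
    rw [e₁]
    exact e₂ ▸ hpo i
  have hf' (i : I) : cW.ι.app i ≫ g = (pushoutFunctorInr s hs f).app i ≫ cB.ι.app i :=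
    ((hpo i).inr_desc _ _ _).symm
  have hg : IsPushout ((pushoutFunctorInr s hs f).app ⊥) (cW.ι.app ⊥) (cB.ι.app ⊥) g := by
    refine IsPushout.of_top ?_ (hf' ⊥).symm (hpo ⊥)
    have e₂ : pushout.inl f (s ⊥) ≫ cB.ι.app ⊥ = v := (hpo ⊥).inl_desc _ _ _
    rw [hsu]
    exact e₂ ▸ sq
  obtain ⟨hr⟩ :=
    nonempty_isColimit_of_isPushout (pushoutFunctorInr s hs f) hα (cB := cB) g hf' hcW hg
  let ι : arrowFunctor (pushoutFunctorInr s hs f) ⟶ (Functor.const _).obj (Arrow.mk g) :=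
    { app := fun i => Arrow.homMk (cW.ι.app i) (cB.ι.app i) (hf' i)
      naturality := fun i j h =>
        Arrow.hom_ext _ _ (cW.ι.naturality h) (cB.ι.naturality h) }
  refine ⟨⟨_, arrowFunctor (pushoutFunctorInr s hs f), ι, ?_, fun i =>
    ⟨hC.pushout (hpo i) hf, ?_, ?_⟩, hα⟩⟩
  · exact Comma.fstSndJointlyReflectColimit (c := Cocone.mk _ ι) hcW hr
  · rw [isCardinalPresentable_iff]
    exact inferInstanceAs (CategoryTheory.IsCardinalPresentable (W.obj i) κ)
  · rw [isCardinalPresentable_iff]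
    exact isCardinalPresentable_of_isPushout (hpo i)

theorem nonempty_pushoutPresentation (hC : IsCellular C) (hK : IsLocallyPresentable κ K)
    {a b : K} {g : a ⟶ b} (hg : Po (betweenPresentable κ C) g) :
    Nonempty (PushoutPresentation κ C (Arrow.mk g)) := by
  have := hK.hasColimits
  obtain ⟨A, B, f, u, v, ⟨hf, hA, hB⟩, sq⟩ := hg
  rw [isCardinalPresentable_iff] at hA hB
  obtain ⟨ι, G, hG, hgen⟩ := hK.generators
  obtain ⟨P, _, Y, c, hc, hP, ⟨e⟩, hY⟩ := hgen a
  have hP := (isCardinalDirected_iff P).1 hP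
  have hY (p : P) : CategoryTheory.IsCardinalPresentable (Y.obj p) κ := by
    obtain ⟨i, ⟨e⟩⟩ := hY p
    have := (isCardinalPresentable_iff (κ := κ) _).1 (hG i)
    exact isCardinalPresentable_of_iso e.symm κ
  obtain ⟨p₀, u₀, hu₀⟩ := IsCardinalPresentable.exists_hom_of_isColimit κ hc (u ≫ e.inv)
  have := isFiltered_of_isCardinalFiltered P κ
  have := IsFiltered.isDirectedOrder P
  have hI : IsCardinalFiltered (Set.Ici p₀) κ := by
    rw [← isCardinalDirected_iff]
    intro S hS
    obtain ⟨p, hp⟩ := (isCardinalDirected_iff P).2 hP (Subtype.val '' S)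
      (Cardinal.mk_image_le.trans_lt hS)
    obtain ⟨q, hpq, hq⟩ := exists_ge_ge p p₀
    exact ⟨⟨q, hq⟩, fun s hs => (hp _ ⟨s, hs, rfl⟩).trans hpq⟩
  have hmono : Monotone (Subtype.val : Set.Ici p₀ → P) := Subtype.mono_coe _
  have := isFiltered_of_isCardinalFiltered (Set.Ici p₀) κ
  have := IsFiltered.isDirectedOrder (Set.Ici p₀)
  have : hmono.functor.Final := hmono.final_functor_iff.2 fun p => by
    obtain ⟨q, hpq, hq⟩ := exists_ge_ge p p₀
    exact ⟨⟨q, hq⟩, hpq⟩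
  let W : Set.Ici p₀ ⥤ K := hmono.functor ⋙ Y
  have hcW' : IsColimit (c.whisker hmono.functor) :=
    (Functor.Final.isColimitWhiskerEquiv hmono.functor c).symm hc
  let cW : Cocone W := (c.whisker hmono.functor).extend e.hom
  have hcW : IsColimit cW := IsColimit.extendIso (s := c.whisker hmono.functor) e.hom hcW'
  let s (i : Set.Ici p₀) : A ⟶ W.obj i := u₀ ≫ Y.map (homOfLE (show p₀ ≤ i.1 from i.2))
  have hsW {i j : Set.Ici p₀} (h : i ⟶ j) : s i ≫ W.map h = s j := by
    refine (assoc _ _ _).trans ?_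
    exact congrArg (u₀ ≫ ·) (Y.map_comp (homOfLE i.2) (hmono.functor.map h)).symm
  have hsu (i : Set.Ici p₀) : s i ≫ cW.ι.app i = u := by
    have h : Y.map (homOfLE (show p₀ ≤ i.1 from i.2)) ≫ c.ι.app i.1 = c.ι.app p₀ := c.w _
    change (u₀ ≫ Y.map (homOfLE (show p₀ ≤ i.1 from i.2))) ≫ c.ι.app i.1 ≫ e.hom = u
    rw [assoc, reassoc_of% h, reassoc_of% hu₀, e.inv_hom_id, comp_id]
  have hW (i : Set.Ici p₀) : CategoryTheory.IsCardinalPresentable (W.obj i) κ := hY _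
  exact nonempty_pushoutPresentation_of_isColimit hC hcW hf s hsW hsu sq

theorem PushoutPresentation.exists_isColimit {g : Arrow K} (D : PushoutPresentation κ C g)
    (hC : IsCellular C) [HasColimits K] (hκ : Cardinal.aleph0 < κ) (p : ℕ ⥤ D.I) :
    ∃ (c : Cocone (p ⋙ D.X)) (_ : IsColimit c) (u : c.pt ⟶ g),
      (∀ n, c.ι.app n ≫ u = D.ι.app (p.obj n)) ∧ betweenPresentable κ C c.pt.hom ∧
      IsPushout c.pt.hom u.left u.right g.hom := by
  have : HasColimitsOfSize.{0, 0} K := hasColimitsOfSizeShrink.{0, 0, v, v} K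
  let c := colimit.cocone (p ⋙ D.X)
  have hc : IsColimit c := colimit.isColimit _
  have hl : IsColimit (Arrow.leftFunc.mapCocone c) := isColimitOfPreserves _ hc
  have hr : IsColimit (Arrow.rightFunc.mapCocone c) := isColimitOfPreserves _ hc
  let u : c.pt ⟶ g := hc.desc ((Cocone.mk g D.ι).whisker p)
  have hu (n : ℕ) : c.ι.app n ≫ u = D.ι.app (p.obj n) := hc.fac _ n
  have hp {i j : D.I} (h : i ⟶ j) :
      IsPushout (D.X.obj i).hom (D.X.map h).left (D.X.map h).right (D.X.obj j).hom := by
    refine IsPushout.of_top ?_ (Arrow.w _).symm (D.isPushout i)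
    rw [← Arrow.comp_left, ← Arrow.comp_right, ← D.X.map_comp]
    exact D.isPushout j
  have hg (i : D.I) : IsPushout (D.X.obj i).hom (D.ι.app i).left (D.ι.app i).right g.hom := by
    have hD : IsPushout (D.X.obj ⊥).hom (D.ι.app ⊥).left (D.ι.app ⊥).right g.hom :=
      isPushout_of_isColimit (Functor.whiskerLeft D.X Arrow.leftToRight) D.isPushout
        (cA := Arrow.leftFunc.mapCocone (Cocone.mk g D.ι))
        (cB := Arrow.rightFunc.mapCocone (Cocone.mk g D.ι)) g.hom
        (fun i => Arrow.w (D.ι.app i)) (isColimitOfPreserves _ D.isColimit)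
        (isColimitOfPreserves _ D.isColimit)
    refine IsPushout.of_top ?_ (Arrow.w (D.ι.app i)).symm (D.isPushout i)
    have := (Cocone.mk g D.ι).w (homOfLE (bot_le : ⊥ ≤ i))
    dsimp at this
    rw [← this] at hD
    exact hD
  have h₀ : IsPushout (D.X.obj (p.obj ⊥)).hom (c.ι.app ⊥).left (c.ι.app ⊥).right c.pt.hom :=
    isPushout_of_isColimit (Functor.whiskerLeft (p ⋙ D.X) Arrow.leftToRight)
      (fun n => hp (p.map (homOfLE bot_le)))
      (cA := Arrow.leftFunc.mapCocone c) (cB := Arrow.rightFunc.mapCocone c) c.pt.hom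
      (fun n => Arrow.w (c.ι.app n)) hl hr
  have hpl (n : ℕ) : CategoryTheory.IsCardinalPresentable
      (((p ⋙ D.X) ⋙ Arrow.leftFunc).obj n) κ :=
    (isCardinalPresentable_iff _).1 (D.mem _).2.1
  have hpr (n : ℕ) : CategoryTheory.IsCardinalPresentable
      (((p ⋙ D.X) ⋙ Arrow.rightFunc).obj n) κ :=
    (isCardinalPresentable_iff _).1 (D.mem _).2.2
  refine ⟨c, hc, u, hu, ⟨hC.pushout h₀ (D.mem _).1, ?_, ?_⟩, ?_⟩
  · exact (isCardinalPresentable_iff _).2 (isCardinalPresentable_of_isColimit_nat hκ hl)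
  · exact (isCardinalPresentable_iff _).2 (isCardinalPresentable_of_isColimit_nat hκ hr)
  · refine IsPushout.of_top ?_ (Arrow.w u).symm h₀
    have := hg (p.obj ⊥)
    rw [← hu] at this
    exact this

end PushoutPresentation

section PsPull

variable {L : Type u'} {M : Type u''} [Category.{v} L] [Category.{v} M]
  {F : K ⥤ M} {G : L ⥤ M}

/-- The image under `F.mapArrow` of a colimit cocone of arrows is a colimit cocone if `F`
preserves the colimits of the given shape. -/
noncomputable def isColimitMapArrow {J : Type w} [SmallCategory J] [HasColimitsOfShape J K]
    (F : K ⥤ M) [PreservesColimitsOfShape J F] {X : J ⥤ Arrow K} {c : Cocone X}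
    (hc : IsColimit c) : IsColimit (F.mapArrow.mapCocone c) :=
  Comma.fstSndJointlyReflectColimit
    (isColimitOfPreserves F (isColimitOfPreserves Arrow.leftFunc hc))
    (isColimitOfPreserves F (isColimitOfPreserves Arrow.rightFunc hc))

theorem PsHom.hom_ext {a b : PsPull F G} {f g : a ⟶ b} (hk : f.hk = g.hk) (hl : f.hl = g.hl) :
    f = g :=
  PsHom.ext hk hl

theorem PsPull.isPushout [PreservesColimitsOfShape WalkingSpan F]
    {a b a' b' : PsPull F G} {f : a ⟶ b} {x : a ⟶ a'} {y : b ⟶ b'} {g : a' ⟶ b'}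
    (hk : IsPushout f.hk x.hk y.hk g.hk) (hl : IsPushout f.hl x.hl y.hl g.hl) :
    IsPushout f x y g := by
  refine ⟨⟨PsHom.hom_ext hk.w hl.w⟩, ⟨PushoutCocone.IsColimit.mk _ (fun s =>
    ⟨hk.desc s.inl.hk s.inr.hk (congrArg PsHom.hk s.condition),
      hl.desc s.inl.hl s.inr.hl (congrArg PsHom.hl s.condition), ?_⟩) ?_ ?_ ?_⟩⟩
  · refine (hk.map F).hom_ext ?_ ?_
    · rw [← F.map_comp_assoc, hk.inl_desc, s.inl.w, reassoc_of% y.w, ← G.map_comp, hl.inl_desc]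
    · rw [← F.map_comp_assoc, hk.inr_desc, s.inr.w, reassoc_of% g.w, ← G.map_comp, hl.inr_desc]
  · intro s
    exact PsHom.hom_ext (hk.inl_desc _ _ _) (hl.inl_desc _ _ _)
  · intro s
    exact PsHom.hom_ext (hk.inr_desc _ _ _) (hl.inr_desc _ _ _)
  · intro s m h₁ h₂
    refine PsHom.hom_ext (hk.hom_ext ?_ ?_) (hl.hom_ext ?_ ?_)
    · exact (congrArg PsHom.hk h₁).trans (hk.inl_desc _ _ _).symm
    · exact (congrArg PsHom.hk h₂).trans (hk.inr_desc _ _ _).symm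
    · exact (congrArg PsHom.hl h₁).trans (hl.inl_desc _ _ _).symm
    · exact (congrArg PsHom.hl h₂).trans (hl.inr_desc _ _ _).symm

theorem PsPull.exists_isPushout [HasPushouts K] [HasPushouts L]
    [PreservesColimitsOfShape WalkingSpan F] [PreservesColimitsOfShape WalkingSpan G]
    {a b a' : PsPull F G} (f : a ⟶ b) (x : a ⟶ a') :
    ∃ (b' : PsPull F G) (y : b ⟶ b') (g : a' ⟶ b'),
      IsPushout f.hk x.hk y.hk g.hk ∧ IsPushout f.hl x.hl y.hl g.hl := by
  have hk := IsPushout.of_hasPushout f.hk x.hk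
  have hl := IsPushout.of_hasPushout f.hl x.hl
  have hk' := hk.map F
  have hl' := hl.map G
  let t : F.obj (pushout f.hk x.hk) ≅ G.obj (pushout f.hl x.hl) :=
    { hom := hk'.desc (b.t.hom ≫ G.map (pushout.inl _ _)) (a'.t.hom ≫ G.map (pushout.inr _ _)) (by
        rw [reassoc_of% f.w, reassoc_of% x.w, hl'.w])
      inv := hl'.desc (b.t.inv ≫ F.map (pushout.inl _ _)) (a'.t.inv ≫ F.map (pushout.inr _ _)) (by
        have hf : G.map f.hl ≫ b.t.inv = a.t.inv ≫ F.map f.hk := by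
          rw [Iso.comp_inv_eq, assoc, f.w, Iso.inv_hom_id_assoc]
        have hx : G.map x.hl ≫ a'.t.inv = a.t.inv ≫ F.map x.hk := by
          rw [Iso.comp_inv_eq, assoc, x.w, Iso.inv_hom_id_assoc]
        rw [reassoc_of% hf, reassoc_of% hx, hk'.w])
      hom_inv_id := by apply hk'.hom_ext <;> simp
      inv_hom_id := by apply hl'.hom_ext <;> simp }
  exact ⟨⟨_, _, t⟩, ⟨pushout.inl _ _, pushout.inl _ _, hk'.inl_desc _ _ _⟩,
    ⟨pushout.inr _ _, pushout.inr _ _, hk'.inr_desc _ _ _⟩, hk, hl⟩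

theorem PsPull.isPushout_iff [HasPushouts K] [HasPushouts L]
    [PreservesColimitsOfShape WalkingSpan F] [PreservesColimitsOfShape WalkingSpan G]
    {a b a' b' : PsPull F G} {f : a ⟶ b} {x : a ⟶ a'} {y : b ⟶ b'} {g : a' ⟶ b'} :
    IsPushout f x y g ↔
      IsPushout f.hk x.hk y.hk g.hk ∧ IsPushout f.hl x.hl y.hl g.hl := by
  refine ⟨fun h => ?_, fun h => PsPull.isPushout h.1 h.2⟩
  obtain ⟨b'', y', g', hk, hl⟩ := PsPull.exists_isPushout f x
  have h' := PsPull.isPushout hk hl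
  let e : b'' ≅ b' := h'.isoIsPushout _ _ h
  have hy : y' ≫ e.hom = y := h'.inl_isoIsPushout_hom _ _ h
  have hg : g' ≫ e.hom = g := h'.inr_isoIsPushout_hom _ _ h
  constructor
  · exact IsPushout.of_iso hk (Iso.refl _) (Iso.refl _) (Iso.refl _) ((projK F G).mapIso e)
      (by simp) (by simp) ((congrArg PsHom.hk hy).trans (id_comp _).symm)
      ((congrArg PsHom.hk hg).trans (id_comp _).symm)
  · exact IsPushout.of_iso hl (Iso.refl _) (Iso.refl _) (Iso.refl _) ((projL F G).mapIso e)
      (by simp) (by simp) ((congrArg PsHom.hl hy).trans (id_comp _).symm)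
      ((congrArg PsHom.hl hg).trans (id_comp _).symm)

end PsPull



/-- `Ps(Po cof_κ(K), Po cof_κ(L)) = Po Ps(cof_κ(K), cof_κ(L))` on the
pseudopullback: a morphism of `P` whose projections are pushouts of cofibrations between
κ-presentable objects is itself a pushout of a morphism whose projections are
cofibrations between κ-presentable objects. -/
theorem ps_po_eq_po_ps {K : Type u} {L : Type u'} {M : Type u''}
    [Category.{v} K] [Category.{v} L] [Category.{v} M]
    (F : K ⥤ M) (G : L ⥤ M) [PreservesColimits F] [PreservesColimits G]
    (cofK : MorphismProperty K) (cofL : MorphismProperty L)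
    (hcellK : IsCellular cofK) (hcellL : IsCellular cofL)
    (hretK : retracts cofK ≤ cofK) (hretL : retracts cofL ≤ cofL)
    (κ : Cardinal.{v}) (hκ : Cardinal.aleph0 < κ)
    (hK : IsLocallyPresentable κ K) (hL : IsLocallyPresentable κ L)
    (hM : IsLocallyPresentable κ M) (hP : IsLocallyPresentable κ (PsPull F G))
    (hsmallK : Small.{v} {f : Arrow K // betweenPresentable κ cofK f.hom})
    (hsmallL : Small.{v} {f : Arrow L // betweenPresentable κ cofL f.hom})
    (hFpres : ∀ A : K, IsCardinalPresentable κ A → IsCardinalPresentable κ (F.obj A))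
    (hGpres : ∀ A : L, IsCardinalPresentable κ A → IsCardinalPresentable κ (G.obj A)) :
    ∀ {a b : PsPull F G} (e : a ⟶ b),
      (Po (betweenPresentable κ cofK) e.hk ∧ Po (betweenPresentable κ cofL) e.hl) ↔
        Po (PsClass (F := F) (G := G)
          (betweenPresentable κ cofK) (betweenPresentable κ cofL)) e := by
  have : Fact κ.IsRegular := ⟨hK.regular⟩
  have := hK.hasColimits
  have := hL.hasColimits
  have := hM.hasColimits
  have : HasColimitsOfSize.{0, 0} K := hasColimitsOfSizeShrink.{0, 0, v, v} K
  have : HasColimitsOfSize.{0, 0} L := hasColimitsOfSizeShrink.{0, 0, v, v} L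
  have : PreservesColimitsOfSize.{0, 0} F := preservesColimitsOfSize_shrink.{0, v, 0, v} F
  have : PreservesColimitsOfSize.{0, 0} G := preservesColimitsOfSize_shrink.{0, v, 0, v} G
  intro a b e
  constructor
  · rintro ⟨hk, hl⟩
    obtain ⟨D₁⟩ := nonempty_pushoutPresentation hcellK hK hk
    obtain ⟨D₂⟩ := nonempty_pushoutPresentation hcellL hL hl
    let t : F.mapArrow.obj (Arrow.mk e.hk) ≅ G.mapArrow.obj (Arrow.mk e.hl) :=
      Arrow.isoMk a.t b.t e.w.symm
    have hU (i : D₁.I) :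
        CategoryTheory.IsCardinalPresentable ((D₁.X ⋙ F.mapArrow).obj i) κ := by
      have h₁ : CategoryTheory.IsCardinalPresentable (F.mapArrow.obj (D₁.X.obj i)).left κ :=
        (isCardinalPresentable_iff _).1 (hFpres _ (D₁.mem i).2.1)
      have h₂ : CategoryTheory.IsCardinalPresentable (F.mapArrow.obj (D₁.X.obj i)).right κ :=
        (isCardinalPresentable_iff _).1 (hFpres _ (D₁.mem i).2.2)
      exact isCardinalPresentable_arrow (F.mapArrow.obj (D₁.X.obj i))
    have hV (i : D₂.I) :
        CategoryTheory.IsCardinalPresentable ((D₂.X ⋙ G.mapArrow).obj i) κ := by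
      have h₁ : CategoryTheory.IsCardinalPresentable (G.mapArrow.obj (D₂.X.obj i)).left κ :=
        (isCardinalPresentable_iff _).1 (hGpres _ (D₂.mem i).2.1)
      have h₂ : CategoryTheory.IsCardinalPresentable (G.mapArrow.obj (D₂.X.obj i)).right κ :=
        (isCardinalPresentable_iff _).1 (hGpres _ (D₂.mem i).2.2)
      exact isCardinalPresentable_arrow (G.mapArrow.obj (D₂.X.obj i))
    obtain ⟨p, q, α, β, hα, hαβ, hβα⟩ := exists_sequences (κ := κ)
      (isColimitMapArrow F D₁.isColimit) (isColimitMapArrow G D₂.isColimit) t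
    obtain ⟨c₁, hc₁, u₁, hu₁, hC₁, sq₁⟩ := D₁.exists_isColimit hcellK hκ p
    obtain ⟨c₂, hc₂, u₂, hu₂, hC₂, sq₂⟩ := D₂.exists_isColimit hcellL hκ q
    obtain ⟨ε, hε⟩ := exists_iso_of_interleaving α β hαβ hβα
      (isColimitMapArrow F hc₁) (isColimitMapArrow G hc₂)
    have hu : F.mapArrow.map u₁ ≫ t.hom = ε.hom ≫ G.mapArrow.map u₂ := by
      refine (isColimitMapArrow F hc₁).hom_ext fun n => ?_
      have h₁ : F.mapArrow.map (c₁.ι.app n) ≫ F.mapArrow.map u₁ =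
          F.mapArrow.map (D₁.ι.app (p.obj n)) :=
        (F.mapArrow.map_comp _ _).symm.trans (congrArg F.mapArrow.map (hu₁ n))
      have h₂ : G.mapArrow.map (c₂.ι.app n) ≫ G.mapArrow.map u₂ =
          G.mapArrow.map (D₂.ι.app (q.obj n)) :=
        (G.mapArrow.map_comp _ _).symm.trans (congrArg G.mapArrow.map (hu₂ n))
      calc F.mapArrow.map (c₁.ι.app n) ≫ F.mapArrow.map u₁ ≫ t.hom
          = F.mapArrow.map (D₁.ι.app (p.obj n)) ≫ t.hom :=
            (assoc _ _ _).symm.trans (congrArg (· ≫ t.hom) h₁)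
        _ = α.app n ≫ G.mapArrow.map (D₂.ι.app (q.obj n)) := (hα n).symm
        _ = (α.app n ≫ G.mapArrow.map (c₂.ι.app n)) ≫ G.mapArrow.map u₂ :=
            (congrArg (α.app n ≫ ·) h₂.symm).trans (assoc _ _ _).symm
        _ = (F.mapArrow.map (c₁.ι.app n) ≫ ε.hom) ≫ G.mapArrow.map u₂ :=
            congrArg (· ≫ G.mapArrow.map u₂) (hε n).symm
        _ = _ := assoc _ _ _
    let a' : PsPull F G := ⟨c₁.pt.left, c₂.pt.left, Arrow.leftFunc.mapIso ε⟩
    let b' : PsPull F G := ⟨c₁.pt.right, c₂.pt.right, Arrow.rightFunc.mapIso ε⟩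
    let e' : a' ⟶ b' := ⟨c₁.pt.hom, c₂.pt.hom, (Arrow.w ε.hom).symm⟩
    let x : a' ⟶ a := ⟨u₁.left, u₂.left, congrArg CommaMorphism.left hu⟩
    let y : b' ⟶ b := ⟨u₁.right, u₂.right, congrArg CommaMorphism.right hu⟩
    exact ⟨a', b', e', x, y, ⟨hC₁, hC₂⟩, PsPull.isPushout sq₁ sq₂⟩
  · rintro ⟨a', b', e', x, y, ⟨hk, hl⟩, sq⟩
    obtain ⟨sqk, sql⟩ := PsPull.isPushout_iff.1 sq
    exact ⟨⟨_, _, _, _, _, hk, sqk⟩, ⟨_, _, _, _, _, hl, sql⟩⟩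

end CellularPaper
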